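/- Let x, y ∈ ℝ^d be nonzero with angle θ = ∠(x,y), let r ∈ ℝ^d have i.i.d. standard Gaussian entries, let D be an independent diagonal matrix of i.i.d. Rademacher signs, and let Φ(x) = sign(C_{r,k} D x) and Φ(y) = sign(C_{r,k} D y) be the k-bit circulant binary embeddings (k ≤ d). Then E[(1/(2k))‖Φ(x) − Φ(y)‖₁] = θ/π, where the expectation is over r and D. -/

import Mathlib

open MeasureTheory ProbabilityTheory Real
open scoped ENNReal

noncomputable section

/-- Entrywise sign: `sgn t = 1` if `t ≥ 0`, `-1` otherwise. -/
def sgn (t : ℝ) : ℝ := if 0 ≤ t then 1 else -1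

/-- Euclidean (ℓ²) norm. -/
def l2norm {ι : Type*} [Fintype ι] (x : ι → ℝ) : ℝ := Real.sqrt (∑ i, x i ^ 2)

/-- Entrywise ℓ¹ norm. -/
def l1norm {ι : Type*} [Fintype ι] (x : ι → ℝ) : ℝ := ∑ i, |x i|

/-- Supremum (ℓ∞) norm. -/
def linf {ι : Type*} [Fintype ι] (x : ι → ℝ) : ℝ := ⨆ i, |x i|

/-- Euclidean inner product. -/
def dotp {ι : Type*} [Fintype ι] (x y : ι → ℝ) : ℝ := ∑ i, x i * y i

/-- Angle between two vectors. -/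
def angle' {ι : Type*} [Fintype ι] (x y : ι → ℝ) : ℝ :=
  Real.arccos (dotp x y / (l2norm x * l2norm y))

/-- The standard Gaussian measure on `ℝ^d` (i.i.d. `N(0,1)` coordinates). -/
def gaussPi (d : ℕ) : Measure (Fin d → ℝ) := Measure.pi fun _ => gaussianReal 0 1

/-- The Rademacher measure on `ℝ`: `±1` with probability `1/2` each. -/
def radMeasure : Measure ℝ := (2 : ℝ≥0∞)⁻¹ • (Measure.dirac 1 + Measure.dirac (-1))

instance : IsProbabilityMeasure radMeasure := by
  constructor
  simp only [radMeasure, Measure.smul_apply, Measure.coe_add, Pi.add_apply,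
    Measure.dirac_apply' _ MeasurableSet.univ, Set.indicator_univ, Pi.one_apply, smul_eq_mul]
  rw [one_add_one_eq_two, ENNReal.inv_mul_cancel] <;> simp

instance (d : ℕ) : IsProbabilityMeasure (gaussPi d) := by
  unfold gaussPi; infer_instance

/-- i.i.d. Rademacher signs on `ℝ^d`. -/
def radPi (d : ℕ) : Measure (Fin d → ℝ) := Measure.pi fun _ => radMeasure

instance (d : ℕ) : IsProbabilityMeasure (radPi d) := by
  unfold radPi; infer_instance

/-- Circular shift by `t` positions: the `j`-th entry of `shift t x` is `x ((j - t) mod d)`. -/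
def shift {d : ℕ} (t : ℕ) (x : Fin d → ℝ) : Fin d → ℝ :=
  fun j => x ⟨((j : ℕ) + (d - t % d)) % d, Nat.mod_lt _ j.pos⟩

/-- The `k`-bit circulant binary embedding: `sign` of the first `k` entries of
`circ(r) · D · x`, where `D = diag D`. -/
def cbe {d k : ℕ} (hk : k ≤ d) (r D x : Fin d → ℝ) : Fin k → ℝ :=
  fun i => sgn (∑ j, r (Fin.castLE hk i - j) * (D j * x j))


lemma measurable_sgn : Measurable sgn :=
  Measurable.ite measurableSet_Ici measurable_const measurable_const

lemma abs_sgn (t : ℝ) : |sgn t| = 1 := by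
  unfold sgn; split_ifs <;> simp

lemma sgn_mul_of_pos {c : ℝ} (hc : 0 < c) (t : ℝ) : sgn (c * t) = sgn t := by
  simp only [sgn, mul_nonneg_iff_of_pos_left hc]

lemma abs_sgn_sub_sgn_le (s t : ℝ) : |sgn s - sgn t| ≤ 2 := by
  refine (abs_sub _ _).trans ?_
  rw [abs_sgn, abs_sgn]; norm_num

/-- The disagreement of two signs, split according to which of them is positive. -/
lemma abs_sgn_sub_sgn (s t : ℝ) :
    |sgn s - sgn t| = 2 * ((if 0 ≤ s ∧ t < 0 then 1 else 0) + (if s < 0 ∧ 0 ≤ t then 1 else 0)) := by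
  by_cases hs : 0 ≤ s <;> by_cases ht : 0 ≤ t <;> norm_num [sgn, hs, ht, ← not_le]

/-- The linear map `r ↦ (⟨r, a⟩, ⟨r, b⟩)`. -/
def pairCLM {d : ℕ} (a b : Fin d → ℝ) : (Fin d → ℝ) →L[ℝ] ℝ × ℝ :=
  (∑ l, a l • ContinuousLinearMap.proj (R := ℝ) (φ := fun _ : Fin d => ℝ) l).prod
    (∑ l, b l • ContinuousLinearMap.proj (R := ℝ) (φ := fun _ : Fin d => ℝ) l)

lemma pairCLM_apply {d : ℕ} (a b r : Fin d → ℝ) :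
    pairCLM a b r = (∑ l, a l * r l, ∑ l, b l * r l) := by
  simp [pairCLM]

lemma charFunDual_gaussPi {d : ℕ} (L : StrongDual ℝ (Fin d → ℝ)) :
    charFunDual (gaussPi d) L =
      Complex.exp (-((∑ i, L (Pi.single i 1) ^ 2 : ℝ) : ℂ) / 2) := by
  have h (i : Fin d) : charFunDual (gaussianReal 0 1) (L.comp (.single ℝ (fun _ => ℝ) i)) =
      Complex.exp (-((L (Pi.single i 1) : ℝ) : ℂ) ^ 2 / 2) := by
    have hL (v : ℝ) : L.comp (.single ℝ (fun _ => ℝ) i) v = L (Pi.single i 1) * v := by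
      have : (Pi.single i v : Fin d → ℝ) = v • Pi.single i 1 := by
        rw [← Pi.single_smul]; simp
      simp [this, mul_comm]
    have := charFun_gaussianReal (μ := 0) (v := 1) (L (Pi.single i 1))
    rw [charFun_apply_real] at this
    rw [charFunDual_apply]
    simp only [hL]
    push_cast
    rw [this]
    congr 1
    simp [neg_div]
  rw [gaussPi, charFunDual_pi]
  simp only [h]
  rw [← Complex.exp_sum]
  congr 1
  push_cast
  rw [← Finset.sum_neg_distrib, Finset.sum_div]

lemma charFunDual_map_pairCLM {d : ℕ} (a b : Fin d → ℝ) (L : StrongDual ℝ (ℝ × ℝ)) :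
    charFunDual ((gaussPi d).map (pairCLM a b)) L =
      Complex.exp (-((L (1, 0) ^ 2 * (∑ i, a i ^ 2) + 2 * L (1, 0) * L (0, 1) * (∑ i, a i * b i)
        + L (0, 1) ^ 2 * (∑ i, b i ^ 2) : ℝ) : ℂ) / 2) := by
  rw [charFunDual_map, charFunDual_gaussPi]
  congr 4
  simp only [Finset.mul_sum, ← Finset.sum_add_distrib]
  refine Finset.sum_congr rfl fun i _ => ?_
  have : L (a i, b i) = a i * L (1, 0) + b i * L (0, 1) := by
    have h : ((a i, b i) : ℝ × ℝ) = a i • (1, 0) + b i • (0, 1) := by simp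
    rw [h, map_add, map_smul, map_smul, smul_eq_mul, smul_eq_mul]
  simp [pairCLM_apply, Pi.single_apply, this]
  ring

/-- The joint law of two Gaussian linear forms depends only on their Gram matrix. -/
lemma map_pairCLM_congr {d e : ℕ} {a b : Fin d → ℝ} {a' b' : Fin e → ℝ}
    (haa : ∑ i, a i ^ 2 = ∑ i, a' i ^ 2) (hab : ∑ i, a i * b i = ∑ i, a' i * b' i)
    (hbb : ∑ i, b i ^ 2 = ∑ i, b' i ^ 2) :
    (gaussPi d).map (pairCLM a b) = (gaussPi e).map (pairCLM a' b') := by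
  have := Measure.isProbabilityMeasure_map (μ := gaussPi d) (pairCLM a b).continuous.aemeasurable
  have := Measure.isProbabilityMeasure_map (μ := gaussPi e) (pairCLM a' b').continuous.aemeasurable
  refine Measure.ext_of_charFunDual (funext fun L => ?_)
  rw [charFunDual_map_pairCLM, charFunDual_map_pairCLM, haa, hab, hbb]

lemma gaussianPDF_mul_polar (r φ : ℝ) :
    gaussianPDF 0 1 (r * cos φ) * gaussianPDF 0 1 (r * sin φ) =
      gaussianPDF 0 1 r * gaussianPDF 0 1 0 := by
  simp only [gaussianPDF]
  rw [← ENNReal.ofReal_mul (gaussianPDFReal_nonneg _ _ _),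
    ← ENNReal.ofReal_mul (gaussianPDFReal_nonneg _ _ _)]
  congr 1
  simp only [gaussianPDFReal, sub_zero, NNReal.coe_one]
  have hexp : rexp (-(r * cos φ) ^ 2 / (2 * 1)) * rexp (-(r * sin φ) ^ 2 / (2 * 1)) =
      rexp (-r ^ 2 / (2 * 1)) * rexp (-0 ^ 2 / (2 * 1)) := by
    rw [← Real.exp_add, ← Real.exp_add]
    congr 1
    linear_combination (-r ^ 2 / 2) * sin_sq_add_cos_sq φ
  linear_combination (√(2 * π * 1))⁻¹ ^ 2 * hexp

/-- The standard Gaussian measure of a planar cone is proportional to its angular measure. -/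
lemma exists_gaussian_cone_eq :
    ∃ c : ℝ≥0∞, ∀ (S : Set (ℝ × ℝ)) (T : Set ℝ), MeasurableSet S → MeasurableSet T →
      (∀ r φ : ℝ, 0 < r → ((r * cos φ, r * sin φ) ∈ S ↔ φ ∈ T)) →
      ((gaussianReal 0 1).prod (gaussianReal 0 1)) S = c * volume (T ∩ Set.Ioo (-π) π) := by
  refine ⟨∫⁻ r in Set.Ioi (0 : ℝ), ENNReal.ofReal r * (gaussianPDF 0 1 r * gaussianPDF 0 1 0),
    fun S T hS hT hST => ?_⟩
  rw [gaussianReal_of_var_ne_zero 0 one_ne_zero,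
    prod_withDensity (measurable_gaussianPDF 0 1) (measurable_gaussianPDF 0 1),
    withDensity_apply _ hS, ← lintegral_indicator hS, ← Measure.volume_eq_prod,
    ← lintegral_comp_polarCoord_symm, polarCoord_target]
  have key : ∀ p ∈ Set.Ioi (0 : ℝ) ×ˢ Set.Ioo (-π) π,
      ENNReal.ofReal p.1 • S.indicator (fun z : ℝ × ℝ => gaussianPDF 0 1 z.1 * gaussianPDF 0 1 z.2)
        (polarCoord.symm p) =
      (fun r => ENNReal.ofReal r * (gaussianPDF 0 1 r * gaussianPDF 0 1 0)) p.1 *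
        T.indicator 1 p.2 := by
    rintro ⟨r, φ⟩ ⟨hr, -⟩
    by_cases h : φ ∈ T
    · have h' := (hST r φ hr).2 h
      simp [polarCoord_symm_apply, h, h', gaussianPDF_mul_polar]
    · have h' := (hST r φ hr).not.2 h
      simp [polarCoord_symm_apply, h, h']
  rw [setLIntegral_congr_fun (measurableSet_Ioi.prod measurableSet_Ioo) key,
    Measure.volume_eq_prod, ← Measure.prod_restrict, lintegral_prod_mul
      (f := fun r => ENNReal.ofReal r * (gaussianPDF 0 1 r * gaussianPDF 0 1 0))
      (g := T.indicator 1) (by fun_prop) (measurable_one.indicator hT).aemeasurable,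
    lintegral_indicator_one hT,
    Measure.restrict_apply hT]

lemma gaussian_cone_eq {S : Set (ℝ × ℝ)} {T : Set ℝ} (hS : MeasurableSet S)
    (hT : MeasurableSet T)
    (hST : ∀ r φ : ℝ, 0 < r → ((r * cos φ, r * sin φ) ∈ S ↔ φ ∈ T)) :
    ((gaussianReal 0 1).prod (gaussianReal 0 1)) S =
      volume (T ∩ Set.Ioo (-π) π) / ENNReal.ofReal (2 * π) := by
  obtain ⟨c, hc⟩ := exists_gaussian_cone_eq
  have h1 := hc Set.univ Set.univ .univ .univ (by simp)
  rw [measure_univ, Set.univ_inter, Real.volume_Ioo, sub_neg_eq_add, ← two_mul] at h1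
  rw [hc S T hS hT hST, ENNReal.div_eq_inv_mul, ENNReal.eq_inv_of_mul_eq_one_left h1.symm]

/-- The angular measure of a wedge between two half-planes making an angle `π - θ`. -/
lemma volume_wedge {θ : ℝ} (h0 : 0 ≤ θ) (hπ : θ ≤ π) {T : Set ℝ}
    (hlow : ∀ φ, 0 < cos φ → cos (φ - θ) < 0 → φ ∈ T)
    (hup : ∀ φ ∈ T, 0 ≤ cos φ ∧ cos (φ - θ) ≤ 0) :
    volume (T ∩ Set.Ioo (-π) π) = ENNReal.ofReal θ := by
  apply le_antisymm
  · have hsub : T ∩ Set.Ioo (-π) π ⊆ Set.Icc (-(π / 2)) (θ - π / 2) ∪ {π / 2} := by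
      rintro φ ⟨hφT, hφ1, hφ2⟩
      obtain ⟨h1, h2⟩ := hup φ hφT
      have hl : -(π / 2) ≤ φ := by
        by_contra! h
        have := cos_neg_of_pi_div_two_lt_of_lt (x := -φ) (by linarith) (by linarith)
        rw [cos_neg] at this
        linarith
      have hu : φ ≤ π / 2 := by
        by_contra! h
        have := cos_neg_of_pi_div_two_lt_of_lt h (by linarith)
        linarith
      by_cases hφ : φ = π / 2
      · exact Or.inr hφ
      · refine Or.inl ⟨hl, ?_⟩
        by_contra! h
        have := lt_of_le_of_ne hu hφ
        have := cos_pos_of_mem_Ioo (x := φ - θ) ⟨by linarith, by linarith⟩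
        linarith
    refine (measure_mono hsub).trans ((measure_union_le _ _).trans ?_)
    rw [Real.volume_Icc, Real.volume_singleton, add_zero]
    exact ENNReal.ofReal_le_ofReal (by linarith)
  · have hsub : Set.Ioo (-(π / 2)) (θ - π / 2) ⊆ T ∩ Set.Ioo (-π) π := by
      rintro φ ⟨h1, h2⟩
      refine ⟨hlow φ (cos_pos_of_mem_Ioo ⟨h1, by linarith⟩) ?_, by linarith [pi_pos],
        by linarith [pi_pos]⟩
      rw [← cos_neg]
      exact cos_neg_of_pi_div_two_lt_of_lt (by linarith) (by linarith)
    refine le_trans (le_of_eq ?_) (measure_mono hsub)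
    rw [Real.volume_Ioo]
    congr 1
    ring

lemma gaussian_wedge {θ : ℝ} (h0 : 0 ≤ θ) (hπ : θ ≤ π) :
    ((gaussianReal 0 1).prod (gaussianReal 0 1))
      {p : ℝ × ℝ | 0 ≤ p.1 ∧ cos θ * p.1 + sin θ * p.2 < 0} = ENNReal.ofReal (θ / (2 * π)) := by
  have hlin : Measurable fun p : ℝ × ℝ => cos θ * p.1 + sin θ * p.2 := by fun_prop
  have hcos : Measurable fun φ => cos (φ - θ) := by fun_prop
  rw [gaussian_cone_eq (T := {φ | 0 ≤ cos φ ∧ cos (φ - θ) < 0}),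
    volume_wedge (T := {φ | 0 ≤ cos φ ∧ cos (φ - θ) < 0}) h0 hπ
      (fun φ h1 h2 => ⟨h1.le, h2⟩) (fun φ h => ⟨h.1, h.2.le⟩),
    ENNReal.ofReal_div_of_pos (by positivity)]
  · exact (measurableSet_le measurable_const measurable_fst).inter
      (measurableSet_lt hlin measurable_const)
  · exact (measurableSet_le measurable_const measurable_cos).inter
      (measurableSet_lt hcos measurable_const)
  · intro r φ hr
    have : cos θ * (r * cos φ) + sin θ * (r * sin φ) = r * cos (φ - θ) := by
      rw [cos_sub]; ring
    simp only [Set.mem_ofPred_eq, this, mul_nonneg_iff_of_pos_left hr, mul_neg_iff, hr, hr.not_gt]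
    simp

lemma gaussian_wedge' {θ : ℝ} (h0 : 0 ≤ θ) (hπ : θ ≤ π) :
    ((gaussianReal 0 1).prod (gaussianReal 0 1))
      {p : ℝ × ℝ | p.1 < 0 ∧ 0 ≤ cos θ * p.1 + sin θ * p.2} = ENNReal.ofReal (θ / (2 * π)) := by
  have hlin : Measurable fun p : ℝ × ℝ => cos θ * p.1 + sin θ * p.2 := by fun_prop
  have hcos : Measurable fun φ => cos (φ - θ) := by fun_prop
  have hmeas : MeasurableSet {p : ℝ × ℝ | p.1 < 0 ∧ 0 ≤ cos θ * p.1 + sin θ * p.2} :=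
    (measurableSet_lt measurable_fst measurable_const).inter
      (measurableSet_le measurable_const hlin)
  have hneg : MeasurePreserving (fun x : ℝ => -x) (gaussianReal 0 1) (gaussianReal 0 1) :=
    ⟨measurable_neg, by simpa using gaussianReal_map_neg (μ := 0) (v := 1)⟩
  rw [← (hneg.prod hneg).measure_preimage hmeas.nullMeasurableSet,
    gaussian_cone_eq (T := {φ | 0 < cos φ ∧ cos (φ - θ) ≤ 0}),
    volume_wedge (T := {φ | 0 < cos φ ∧ cos (φ - θ) ≤ 0}) h0 hπ
      (fun φ h1 h2 => ⟨h1, h2.le⟩) (fun φ h => ⟨h.1.le, h.2⟩),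
    ENNReal.ofReal_div_of_pos (by positivity)]
  · exact (hneg.prod hneg).measurable hmeas
  · exact (measurableSet_lt measurable_const measurable_cos).inter
      (measurableSet_le hcos measurable_const)
  · intro r φ hr
    have : cos θ * -(r * cos φ) + sin θ * -(r * sin φ) = -(r * cos (φ - θ)) := by
      rw [cos_sub]; ring
    simp only [Set.mem_preimage, Prod.map_apply, Set.mem_ofPred_eq, this, Left.neg_neg_iff,
      Left.nonneg_neg_iff, mul_pos_iff_of_pos_left hr, mul_nonpos_iff, hr.le, hr.not_ge]
    simp

lemma integral_abs_sgn_sub_sgn_gaussian {θ : ℝ} (h0 : 0 ≤ θ) (hπ : θ ≤ π) :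
    ∫ p : ℝ × ℝ, |sgn p.1 - sgn (cos θ * p.1 + sin θ * p.2)|
      ∂((gaussianReal 0 1).prod (gaussianReal 0 1)) = 2 * (θ / π) := by
  have hlin : Measurable fun p : ℝ × ℝ => cos θ * p.1 + sin θ * p.2 := by fun_prop
  have hm1 : MeasurableSet {p : ℝ × ℝ | 0 ≤ p.1 ∧ cos θ * p.1 + sin θ * p.2 < 0} :=
    (measurableSet_le measurable_const measurable_fst).inter
      (measurableSet_lt hlin measurable_const)
  have hm2 : MeasurableSet {p : ℝ × ℝ | p.1 < 0 ∧ 0 ≤ cos θ * p.1 + sin θ * p.2} :=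
    (measurableSet_lt measurable_fst measurable_const).inter
      (measurableSet_le measurable_const hlin)
  have heq : (fun p : ℝ × ℝ => |sgn p.1 - sgn (cos θ * p.1 + sin θ * p.2)|) = fun p =>
      2 * ({p : ℝ × ℝ | 0 ≤ p.1 ∧ cos θ * p.1 + sin θ * p.2 < 0}.indicator 1 p +
        {p : ℝ × ℝ | p.1 < 0 ∧ 0 ≤ cos θ * p.1 + sin θ * p.2}.indicator 1 p) := by
    funext p
    simp [abs_sgn_sub_sgn, Set.indicator_apply]
  rw [heq, integral_const_mul, integral_add ((integrable_const 1).indicator hm1)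
    ((integrable_const 1).indicator hm2), integral_indicator_one hm1, integral_indicator_one hm2,
    measureReal_def, measureReal_def, gaussian_wedge h0 hπ, gaussian_wedge' h0 hπ,
    ENNReal.toReal_ofReal (by positivity)]
  field_simp
  ring

lemma l2norm_sq {ι : Type*} [Fintype ι] (x : ι → ℝ) : l2norm x ^ 2 = ∑ i, x i ^ 2 :=
  Real.sq_sqrt (Finset.sum_nonneg fun i _ => sq_nonneg (x i))

lemma l2norm_pos {ι : Type*} [Fintype ι] {x : ι → ℝ} (hx : x ≠ 0) : 0 < l2norm x := by
  obtain ⟨i, hi⟩ := Function.ne_iff.1 hx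
  exact Real.sqrt_pos.2 (Finset.sum_pos' (fun j _ => sq_nonneg (x j))
    ⟨i, Finset.mem_univ i, by simpa using sq_pos_of_ne_zero hi⟩)

lemma dotp_eq_mul_cos_angle {ι : Type*} [Fintype ι] {x y : ι → ℝ} (hx : x ≠ 0) (hy : y ≠ 0) :
    dotp x y = l2norm x * l2norm y * cos (angle' x y) := by
  have hpos := mul_pos (l2norm_pos hx) (l2norm_pos hy)
  have hcs : |dotp x y| ≤ l2norm x * l2norm y := by
    refine abs_le_of_sq_le_sq ?_ hpos.le
    rw [mul_pow, l2norm_sq, l2norm_sq]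
    exact Finset.sum_mul_sq_le_sq_mul_sq _ _ _
  have habs := abs_le.1 hcs
  rw [angle', cos_arccos ((le_div_iff₀ hpos).2 (by linarith)) ((div_le_one hpos).2 habs.2),
    mul_div_cancel₀ _ hpos.ne']

/-- Grothendieck's identity, in terms of the Gram matrix of the two directions. -/
lemma integral_abs_sgn_sub_sgn_gaussPi {d : ℕ} {a b : Fin d → ℝ} {n m θ : ℝ} (hn : 0 < n)
    (hm : 0 < m) (h0 : 0 ≤ θ) (hπ : θ ≤ π) (haa : ∑ i, a i ^ 2 = n ^ 2)
    (hbb : ∑ i, b i ^ 2 = m ^ 2) (hab : ∑ i, a i * b i = n * m * cos θ) :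
    ∫ r, |sgn (∑ i, a i * r i) - sgn (∑ i, b i * r i)| ∂(gaussPi d) = 2 * (θ / π) := by
  have hF : Measurable fun p : ℝ × ℝ => |sgn p.1 - sgn p.2| :=
    ((measurable_sgn.comp measurable_fst).sub (measurable_sgn.comp measurable_snd)).abs
  have hlaw := map_pairCLM_congr (a := a) (b := b) (a' := ![n, 0])
    (b' := ![m * cos θ, m * sin θ]) (by simp [haa]) (by simp [hab]; ring)
    (by simp [hbb]; linear_combination (-m ^ 2) * sin_sq_add_cos_sq θ)
  have h1 := integral_map (μ := gaussPi d) (pairCLM a b).continuous.aemeasurable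
    hF.aestronglyMeasurable
  have h2 := integral_map (μ := gaussPi 2)
    (pairCLM ![n, 0] ![m * cos θ, m * sin θ]).continuous.aemeasurable hF.aestronglyMeasurable
  rw [← hlaw, h1] at h2
  simp only [pairCLM_apply] at h2
  rw [h2, ← integral_abs_sgn_sub_sgn_gaussian h0 hπ,
    ← (measurePreserving_piFinTwo fun _ => gaussianReal 0 1).integral_comp']
  refine integral_congr_ae (Filter.Eventually.of_forall fun r => ?_)
  have : m * cos θ * r 0 + m * sin θ * r 1 = m * (cos θ * r 0 + sin θ * r 1) := by ring
  simp [sgn_mul_of_pos hn, this, sgn_mul_of_pos hm]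

lemma radPi_ae_sq_eq_one (d : ℕ) : ∀ᵐ D ∂(radPi d), ∀ j, D j ^ 2 = 1 := by
  refine Filter.eventually_all.2 fun j => ?_
  have : ∀ᵐ t ∂radMeasure, t ^ 2 = 1 := by
    refine Measure.ae_smul_measure ?_ _
    rw [ae_add_measure_iff]
    exact ⟨by simp [ae_dirac_eq], by simp [ae_dirac_eq]⟩
  exact (Measure.tendsto_eval_ae_ae (μ := fun _ : Fin d => radMeasure) (i := j)).eventually this

lemma sum_reflect {d : ℕ} (i : Fin d) (f : Fin d → ℝ) : ∑ j, f (i - j) = ∑ j, f j := by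
  have : NeZero d := ⟨(Fin.pos i).ne'⟩
  exact (Equiv.subLeft i).sum_comp f

lemma sum_mul_reflect {d : ℕ} (i : Fin d) (r u : Fin d → ℝ) :
    ∑ j, r (i - j) * u j = ∑ l, u (i - l) * r l := by
  have : NeZero d := ⟨(Fin.pos i).ne'⟩
  rw [← sum_reflect i]
  simp [mul_comm]

/-- The expected (normalized) Hamming distance of the `k`-bit circulant binary embeddings of
nonzero `x, y` equals `θ/π`, where `θ = ∠(x,y)`; the expectation is over the Gaussian vector `r`
and the Rademacher signs `D`. -/
theorem stmt4 {d k : ℕ} (hk : k ≤ d) (hk0 : 0 < k) (x y : Fin d → ℝ) (hx : x ≠ 0) (hy : y ≠ 0)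
    (θ : ℝ) (hθ : θ = angle' x y) :
    (∫ ω : (Fin d → ℝ) × (Fin d → ℝ),
        (1 / (2 * (k : ℝ))) * l1norm (cbe hk ω.1 ω.2 x - cbe hk ω.1 ω.2 y)
        ∂((gaussPi d).prod (radPi d))) = θ / π := by
  have hk0' : (k : ℝ) ≠ 0 := by exact_mod_cast hk0.ne'
  have hmeas (i : Fin k) : Measurable fun ω : (Fin d → ℝ) × (Fin d → ℝ) =>
      |cbe hk ω.1 ω.2 x i - cbe hk ω.1 ω.2 y i| := by
    unfold cbe
    refine ((measurable_sgn.comp ?_).sub (measurable_sgn.comp ?_)).abs <;> fun_prop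
  have hint (i : Fin k) : Integrable (fun ω : (Fin d → ℝ) × (Fin d → ℝ) =>
      |cbe hk ω.1 ω.2 x i - cbe hk ω.1 ω.2 y i|) ((gaussPi d).prod (radPi d)) :=
    .of_bound (hmeas i).aestronglyMeasurable 2 (.of_forall fun ω => by
      rw [Real.norm_eq_abs, abs_abs]; exact abs_sgn_sub_sgn_le _ _)
  have hbit (i : Fin k) : ∫ ω : (Fin d → ℝ) × (Fin d → ℝ),
      |cbe hk ω.1 ω.2 x i - cbe hk ω.1 ω.2 y i| ∂((gaussPi d).prod (radPi d)) = 2 * (θ / π) := by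
    rw [integral_prod_symm _ (hint i)]
    have hinner : ∀ᵐ D ∂(radPi d), ∫ r, |cbe hk r D x i - cbe hk r D y i| ∂(gaussPi d) =
        2 * (θ / π) := by
      filter_upwards [radPi_ae_sq_eq_one d] with D hD
      simp only [cbe, sum_mul_reflect _ _ fun j => D j * x j,
        sum_mul_reflect _ _ fun j => D j * y j]
      have hθ' : 0 ≤ θ ∧ θ ≤ π := hθ ▸ ⟨arccos_nonneg _, arccos_le_pi _⟩
      refine integral_abs_sgn_sub_sgn_gaussPi (l2norm_pos hx) (l2norm_pos hy) hθ'.1 hθ'.2 ?_ ?_ ?_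
      · rw [sum_reflect (Fin.castLE hk i) fun j => (D j * x j) ^ 2, l2norm_sq]
        simp [mul_pow, hD]
      · rw [sum_reflect (Fin.castLE hk i) fun j => (D j * y j) ^ 2, l2norm_sq]
        simp [mul_pow, hD]
      · rw [sum_reflect (Fin.castLE hk i) fun j => D j * x j * (D j * y j), hθ,
          ← dotp_eq_mul_cos_angle hx hy, dotp]
        refine Finset.sum_congr rfl fun j _ => ?_
        linear_combination (x j * y j) * hD j
    rw [integral_congr_ae hinner]
    simp
  simp only [l1norm, Pi.sub_apply]
  rw [integral_const_mul, integral_finsetSum _ fun i _ => hint i]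
  simp only [hbit, Finset.sum_const, Finset.card_univ, Fintype.card_fin, nsmul_eq_mul]
  field_simp

end
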